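/- Let Y be a symmetric real random variable (−Y has the same distribution as Y) with a Lebesgue density, 𝔼Y = 0, 𝔼Y² = 1, and finite χ²-distance to the standard normal. If χ²(Y,𝒩) < 1.97, then 𝔼 e^{tY} < e^{t²} for all real t ≠ 0. -/

import Mathlib

open MeasureTheory ProbabilityTheory Real

/-- Density of the standard normal distribution. -/
noncomputable def stdGaussianDensity (x : ℝ) : ℝ := Real.exp (-x^2/2) / Real.sqrt (2*Real.pi)

/-- χ² distance between (the law of) a random variable `X` (with Lebesgue density given by
`MeasureTheory.pdf`) and the standard normal distribution. -/
noncomputable def chiSqDist {Ω : Type*} [MeasureSpace Ω] (X : Ω → ℝ) : ℝ :=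
  ∫ x, ((MeasureTheory.pdf X ℙ volume x).toReal / stdGaussianDensity x - 1)^2
    * stdGaussianDensity x

/-- The χ² distance of `X` to the standard normal is finite (the defining integral converges). -/
def HasFiniteChiSq {Ω : Type*} [MeasureSpace Ω] (X : Ω → ℝ) : Prop :=
  MeasureTheory.Integrable (fun x =>
    ((MeasureTheory.pdf X ℙ volume x).toReal / stdGaussianDensity x - 1)^2
      * stdGaussianDensity x)

/-- Upper bound for `exp` on an interval by the chord through upper bounds at the endpoints. -/
lemma exp_le_chord {a b A B w : ℝ} (hab : a < b) (haw : a ≤ w) (hwb : w ≤ b)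
    (hA : exp a ≤ A) (hB : exp b ≤ B) : exp w ≤ A + (B - A) / (b - a) * (w - a) := by
  have hd : 0 < b - a := sub_pos.2 hab
  have h := convexOn_exp.2 (Set.mem_univ a) (Set.mem_univ b)
    (show 0 ≤ (b - w) / (b - a) from div_nonneg (by linarith) hd.le)
    (show 0 ≤ (w - a) / (b - a) from div_nonneg (by linarith) hd.le) (by field_simp; ring)
  have hw : (b - w) / (b - a) * a + (w - a) / (b - a) * b = w := by field_simp; ring
  simp only [smul_eq_mul] at h
  rw [hw] at h
  calc exp w ≤ _ := h
    _ ≤ (b - w) / (b - a) * A + (w - a) / (b - a) * B := by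
      gcongr
    _ = _ := by field_simp; ring

lemma exp_eighth_lt : exp (1 / 8) < 1.1331485 := by
  have h := Real.exp_bound' (x := 1 / 8) (by norm_num) (by norm_num) (n := 6) (by norm_num)
  norm_num [Finset.sum_range_succ, Nat.factorial] at h ⊢
  linarith

lemma exp_nat_div_eight_le (n : ℕ) : exp (n / 8) ≤ 1.1331485 ^ n := by
  rw [show (n : ℝ) / 8 = n * (1 / 8) by ring, exp_nat_mul]
  exact pow_le_pow_left₀ (exp_pos _).le exp_eighth_lt.le n

lemma exp_neg_two_mul_le {w : ℝ} (n : ℕ) (hw : n / 8 ≤ w) :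
    exp (-2 * w) ≤ ((1.133 : ℝ) ^ (2 * n))⁻¹ := by
  have h8 : (1.133 : ℝ) ≤ exp (1 / 8) := by
    have := Real.sum_le_exp_of_nonneg (x := 1 / 8) (by norm_num) 4
    norm_num [Finset.sum_range_succ, Nat.factorial] at this ⊢
    linarith
  rw [neg_mul, exp_neg]
  refine inv_anti₀ (by positivity) ((pow_le_pow_left₀ (by norm_num) h8 _).trans ?_)
  rw [← exp_nat_mul, exp_le_exp]
  push_cast
  linarith

lemma cosh_two_mul_eq_exp (w : ℝ) : cosh (2 * w) = (exp w ^ 2 + exp (-2 * w)) / 2 := by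
  rw [cosh_eq, ← exp_nat_mul]; push_cast; ring_nf

lemma cosh_gap_of_exp_le {w U V : ℝ} (hU : exp w ≤ U) (hU' : U ≤ 66) (hV : exp (-2 * w) ≤ V)
    (h : 0 ≤ 0.015 * U ^ 2 - 2 * U + 2.97 + 3.94 * w ^ 2 - 0.985 * V) :
    1.97 * (cosh (2 * w) - 1 - (2 * w) ^ 2 / 2) ≤ (exp w - 1) ^ 2 := by
  rw [cosh_two_mul_eq_exp]
  nlinarith [mul_nonneg (sub_nonneg.2 hU) (show 0 ≤ 2 - 0.015 * (U + exp w) by linarith)]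

lemma cosh_gap_of_mem_chord {w B C : ℝ} (m n : ℕ) (hmn : m < n)
    (hmw : m / 8 ≤ w) (hwn : w ≤ n / 8)
    (hB : (1.1331485 : ℝ) ^ m ≤ B) (hC : (1.1331485 : ℝ) ^ n ≤ C) (hBC : B ≤ C) (hC' : C ≤ 66)
    (h : 0 ≤ 0.015 * (B + (C - B) / (n / 8 - m / 8) * (w - m / 8)) ^ 2
      - 2 * (B + (C - B) / (n / 8 - m / 8) * (w - m / 8)) + 2.97 + 3.94 * w ^ 2
      - 0.985 * ((1.133 : ℝ) ^ (2 * m))⁻¹) :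
    1.97 * (cosh (2 * w) - 1 - (2 * w) ^ 2 / 2) ≤ (exp w - 1) ^ 2 := by
  have hmn' : (m : ℝ) / 8 < n / 8 := by
    have : (m : ℝ) < n := by exact_mod_cast hmn
    linarith
  refine cosh_gap_of_exp_le (exp_le_chord hmn' hmw hwn ((exp_nat_div_eight_le m).trans hB)
    ((exp_nat_div_eight_le n).trans hC)) ?_ (exp_neg_two_mul_le m hmw) h
  have : (C - B) / (n / 8 - m / 8) * (w - m / 8) ≤ C - B := by
    rw [div_mul_eq_mul_div, div_le_iff₀ (by linarith)]
    exact mul_le_mul_of_nonneg_left (by linarith) (by linarith)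
  linarith

lemma cosh_gap_of_small {w : ℝ} (h0 : 0 ≤ w) (h1 : w ≤ 3 / 8) :
    1.97 * (cosh (2 * w) - 1 - (2 * w) ^ 2 / 2) ≤ (exp w - 1) ^ 2 := by
  have hc := cosh_le_exp_half_sq (2 * w)
  have he := (abs_le.1 (abs_exp_sub_one_sub_id_le (x := (2 * w) ^ 2 / 2)
    (by rw [abs_of_nonneg (by positivity)]; nlinarith))).2
  have hq : 0 ≤ w + w ^ 2 / 2 := by positivity
  have hw := pow_le_pow_left₀ hq
    (show w + w ^ 2 / 2 ≤ exp w - 1 by linarith [quadratic_le_exp_of_nonneg h0]) 2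
  have hf : 0 ≤ w ^ 2 * (1 + w - 8 * w ^ 2 + w ^ 2 / 4) :=
    mul_nonneg (sq_nonneg w) (by nlinarith)
  nlinarith [sq_nonneg (w ^ 2)]

/-- The numerical inequality behind the constant `1.97`. -/
lemma cosh_gap {w : ℝ} (h0 : 0 ≤ w) :
    1.97 * (cosh (2 * w) - 1 - (2 * w) ^ 2 / 2) ≤ (exp w - 1) ^ 2 := by
  rcases le_total w (3 / 8) with h1 | h1
  · exact cosh_gap_of_small h0 h1
  rcases le_total w (9 / 8) with h2 | h2
  · refine cosh_gap_of_mem_chord (B := 1.456) (C := 3.081) 3 9 (by norm_num) (by norm_num; linarith)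
      (by norm_num; linarith) (by norm_num) (by norm_num) (by norm_num) (by norm_num) ?_
    norm_num
    nlinarith [sq_nonneg (w - 0.535)]
  rcases le_total w (22 / 8) with h2 | h2
  · refine cosh_gap_of_mem_chord (B := 3.081) (C := 15.643) 9 22 (by norm_num) (by norm_num; linarith)
      (by norm_num; linarith) (by norm_num) (by norm_num) (by norm_num) (by norm_num) ?_
    norm_num
    nlinarith [sq_nonneg (w - 1.733)]
  rcases le_total w (28 / 8) with h2 | h2
  · refine cosh_gap_of_mem_chord (B := 15.643) (C := 33.116) 22 28 (by norm_num) (by norm_num; linarith)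
      (by norm_num; linarith) (by norm_num) (by norm_num) (by norm_num) (by norm_num) ?_
    norm_num
    nlinarith [sq_nonneg (w - 3.329)]
  rcases le_total w (30 / 8) with h2 | h2
  · refine cosh_gap_of_mem_chord (B := 33.116) (C := 42.522) 28 30 (by norm_num) (by norm_num; linarith)
      (by norm_num; linarith) (by norm_num) (by norm_num) (by norm_num) (by norm_num) ?_
    norm_num
    nlinarith [sq_nonneg (w - 3.704)]
  rcases le_total w (33 / 8) with h2 | h2
  · refine cosh_gap_of_mem_chord (B := 42.522) (C := 61.868) 30 33 (by norm_num) (by norm_num; linarith)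
      (by norm_num; linarith) (by norm_num) (by norm_num) (by norm_num) (by norm_num) ?_
    norm_num
    nlinarith [sq_nonneg (w - 3.839)]
  have hV : exp (-2 * w) ≤ 1 := exp_le_one_iff.2 (by linarith)
  rw [cosh_two_mul_eq_exp]
  nlinarith [sq_nonneg (exp w - 200 / 3)]

/-- `f` is integrable with integral `v`. -/
def HasMean {α : Type*} [MeasurableSpace α] (μ : Measure α) (f : α → ℝ) (v : ℝ) : Prop :=
  Integrable f μ ∧ ∫ x, f x ∂μ = v

namespace HasMean

variable {α : Type*} [MeasurableSpace α] {μ : Measure α} {f g : α → ℝ} {v w : ℝ}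

lemma add (hf : HasMean μ f v) (hg : HasMean μ g w) :
    HasMean μ (fun x => f x + g x) (v + w) :=
  ⟨hf.1.add hg.1, by rw [integral_add hf.1 hg.1, hf.2, hg.2]⟩

lemma const_mul (c : ℝ) (hf : HasMean μ f v) : HasMean μ (fun x => c * f x) (c * v) :=
  ⟨hf.1.const_mul c, by rw [integral_const_mul, hf.2]⟩

lemma sub (hf : HasMean μ f v) (hg : HasMean μ g w) :
    HasMean μ (fun x => f x - g x) (v - w) :=
  ⟨hf.1.sub hg.1, by rw [integral_sub hf.1 hg.1, hf.2, hg.2]⟩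

lemma congr (hf : HasMean μ f v) (hfg : ∀ x, g x = f x) (hvw : v = w) : HasMean μ g w := by
  rw [← hvw, funext hfg]; exact hf

end HasMean

lemma mem_interior_integrableExpSet_gaussianReal (c : ℝ) :
    c ∈ interior (integrableExpSet id (gaussianReal 0 1)) := by
  simp [integrableExpSet_id_gaussianReal]

lemma integrable_pow_mul_exp_gaussianReal (n : ℕ) (c : ℝ) :
    Integrable (fun x => x ^ n * exp (c * x)) (gaussianReal 0 1) := by
  simpa using integrable_pow_mul_exp_of_mem_interior_integrableExpSet
    (mem_interior_integrableExpSet_gaussianReal c) n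

lemma integral_pow_succ_mul_exp_gaussianReal {n : ℕ} {F F' : ℝ → ℝ}
    (hF : ∀ c, ∫ x, x ^ n * exp (c * x) ∂(gaussianReal 0 1) = F c)
    (hF' : ∀ c, HasDerivAt F (F' c) c) (c : ℝ) :
    ∫ x, x ^ (n + 1) * exp (c * x) ∂(gaussianReal 0 1) = F' c := by
  have h := hasDerivAt_integral_pow_mul_exp_real
    (mem_interior_integrableExpSet_gaussianReal c) n
  simp only [id_eq, hF] at h
  exact h.unique (hF' c)

lemma hasDerivAt_mul_exp_half_sq {P : ℝ → ℝ} {P' c : ℝ} (hP : HasDerivAt P P' c) :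
    HasDerivAt (fun c => P c * exp (c ^ 2 / 2)) ((P' + c * P c) * exp (c ^ 2 / 2)) c := by
  refine (hP.mul (((hasDerivAt_pow 2 c).div_const 2).exp)).congr_deriv ?_
  push_cast; ring

lemma integral_exp_gaussianReal (c : ℝ) :
    ∫ x, exp (c * x) ∂(gaussianReal 0 1) = exp (c ^ 2 / 2) := by
  simpa [mgf] using congrFun (mgf_id_gaussianReal (μ := 0) (v := 1)) c

lemma integral_pow_mul_exp_gaussianReal (c : ℝ) :
    ∫ x, x ^ 2 * exp (c * x) ∂(gaussianReal 0 1) = (1 + c ^ 2) * exp (c ^ 2 / 2) ∧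
    ∫ x, x ^ 4 * exp (c * x) ∂(gaussianReal 0 1) = (3 + 6 * c ^ 2 + c ^ 4) * exp (c ^ 2 / 2) := by
  have h0 (c : ℝ) : ∫ x, x ^ 0 * exp (c * x) ∂(gaussianReal 0 1) = 1 * exp (c ^ 2 / 2) := by
    simpa using integral_exp_gaussianReal c
  have h1 (c : ℝ) : ∫ x, x ^ 1 * exp (c * x) ∂(gaussianReal 0 1) = c * exp (c ^ 2 / 2) := by
    rw [integral_pow_succ_mul_exp_gaussianReal h0
      (fun c => hasDerivAt_mul_exp_half_sq (hasDerivAt_const c 1))]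
    ring
  have h2 (c : ℝ) : ∫ x, x ^ 2 * exp (c * x) ∂(gaussianReal 0 1)
      = (1 + c ^ 2) * exp (c ^ 2 / 2) := by
    rw [integral_pow_succ_mul_exp_gaussianReal h1
      (fun c => hasDerivAt_mul_exp_half_sq (hasDerivAt_id' c))]
    ring
  have h3 (c : ℝ) : ∫ x, x ^ 3 * exp (c * x) ∂(gaussianReal 0 1)
      = (3 * c + c ^ 3) * exp (c ^ 2 / 2) := by
    rw [integral_pow_succ_mul_exp_gaussianReal h2
      (fun c => hasDerivAt_mul_exp_half_sq ((hasDerivAt_pow 2 c).const_add 1))]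
    push_cast; ring
  refine ⟨h2 c, ?_⟩
  rw [integral_pow_succ_mul_exp_gaussianReal h3 (fun c => hasDerivAt_mul_exp_half_sq
    (((hasDerivAt_id' c).const_mul 3).fun_add (hasDerivAt_pow 3 c)))]
  push_cast; ring

lemma hasMean_exp_gaussianReal (c : ℝ) :
    HasMean (gaussianReal 0 1) (fun x => exp (c * x)) (exp (c ^ 2 / 2)) :=
  ⟨by simpa using integrable_pow_mul_exp_gaussianReal 0 c, integral_exp_gaussianReal c⟩

lemma hasMean_sq_mul_exp_gaussianReal (c : ℝ) :
    HasMean (gaussianReal 0 1) (fun x => x ^ 2 * exp (c * x)) ((1 + c ^ 2) * exp (c ^ 2 / 2)) :=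
  ⟨integrable_pow_mul_exp_gaussianReal 2 c, (integral_pow_mul_exp_gaussianReal c).1⟩

lemma hasMean_one {α : Type*} [MeasurableSpace α] (μ : Measure α) [IsProbabilityMeasure μ] :
    HasMean μ (fun _ => 1) 1 := ⟨integrable_const 1, by simp⟩

lemma hasMean_sq_gaussianReal : HasMean (gaussianReal 0 1) (fun x => x ^ 2) 1 := by
  simpa using hasMean_sq_mul_exp_gaussianReal 0

lemma hasMean_pow_four_gaussianReal : HasMean (gaussianReal 0 1) (fun x => x ^ 4) 3 := by
  constructor
  · simpa using integrable_pow_mul_exp_gaussianReal 4 0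
  · simpa using (integral_pow_mul_exp_gaussianReal 0).2

/-- The part of `exp (t * x - t ^ 2 / 2)` that is even in `x` and orthogonal, in
`L²(gaussianReal 0 1)`, to the polynomials of degree at most three. -/
noncomputable def evenExpTail (t x : ℝ) : ℝ :=
  exp (-(t ^ 2 / 2)) / 2 * (exp (t * x) + exp (-t * x)) - 1 - t ^ 2 / 2 * (x ^ 2 - 1)

lemma continuous_evenExpTail (t : ℝ) : Continuous (evenExpTail t) := by
  unfold evenExpTail; fun_prop

/-- The mean of `evenExpTail t ∘ X` from the second moment and the exponential moments of `X`. -/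
lemma HasMean.evenExpTail {α : Type*} [MeasurableSpace α] {μ : Measure α} [IsProbabilityMeasure μ]
    {X : α → ℝ} {t M : ℝ} (hsq : HasMean μ (fun x => X x ^ 2) 1)
    (hpos : HasMean μ (fun x => exp (t * X x)) M) (hneg : HasMean μ (fun x => exp (-t * X x)) M) :
    HasMean μ (fun x => evenExpTail t (X x)) (exp (-(t ^ 2 / 2)) * M - 1) :=
  ((((hpos.add hneg).const_mul (exp (-(t ^ 2 / 2)) / 2)).sub (hasMean_one μ)).sub
    ((hsq.sub (hasMean_one μ)).const_mul (t ^ 2 / 2))).congr (fun _ => rfl) (by ring)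

lemma hasMean_evenExpTail_gaussianReal (t : ℝ) :
    HasMean (gaussianReal 0 1) (evenExpTail t) 0 := by
  have hneg := hasMean_exp_gaussianReal (-t)
  rw [neg_sq] at hneg
  refine (HasMean.evenExpTail hasMean_sq_gaussianReal (hasMean_exp_gaussianReal t) hneg).congr
    (fun _ => rfl) ?_
  rw [← exp_add]; simp

lemma hasMean_evenExpTail_sq_gaussianReal (t : ℝ) :
    HasMean (gaussianReal 0 1) (fun x => evenExpTail t x ^ 2)
      (cosh (t ^ 2) - 1 - (t ^ 2) ^ 2 / 2) := by
  obtain ⟨a, ha⟩ : ∃ a, exp (-(t ^ 2 / 2)) = a := ⟨_, rfl⟩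
  obtain ⟨b, hb⟩ : ∃ b, t ^ 2 / 2 - 1 = b := ⟨_, rfl⟩
  have hsum := (((((hasMean_exp_gaussianReal (2 * t)).add
      (hasMean_exp_gaussianReal (-(2 * t)))).const_mul (a ^ 2 / 4)).add
    (((hasMean_exp_gaussianReal t).add (hasMean_exp_gaussianReal (-t))).const_mul (a * b))).add
    ((hasMean_one (gaussianReal 0 1)).const_mul (a ^ 2 / 2 + b ^ 2))).add
    (((hasMean_pow_four_gaussianReal.const_mul (t ^ 4 / 4)).sub
      (((hasMean_sq_mul_exp_gaussianReal t).add
        (hasMean_sq_mul_exp_gaussianReal (-t))).const_mul (a * t ^ 2 / 2))).sub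
      (hasMean_sq_gaussianReal.const_mul (b * t ^ 2)))
  refine hsum.congr (fun x => ?_) ?_
  · have h1 : exp (2 * t * x) = exp (t * x) ^ 2 := by rw [← exp_nat_mul]; push_cast; ring_nf
    have h2 : exp (-(2 * t) * x) = exp (-t * x) ^ 2 := by rw [← exp_nat_mul]; push_cast; ring_nf
    have h3 : exp (t * x) * exp (-t * x) = 1 := by rw [← exp_add]; simp
    rw [evenExpTail, h1, h2, ha, ← hb]
    linear_combination (a ^ 2 / 2) * h3
  · have h1 : a * exp (t ^ 2 / 2) = 1 := by rw [← ha, ← exp_add]; simp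
    have h2 : a ^ 2 = exp (-t ^ 2) := by rw [← ha, ← exp_nat_mul]; push_cast; ring_nf
    have h3 : a ^ 2 * exp ((2 * t) ^ 2 / 2) = exp (t ^ 2) := by
      rw [h2, ← exp_add]; ring_nf
    rw [neg_sq, neg_sq, cosh_eq, ← hb]
    linear_combination h3 / 2 + h2 / 2 + (2 * (t ^ 2 / 2 - 1) - t ^ 2 * (1 + t ^ 2)) * h1

lemma stdGaussianDensity_eq_gaussianPDFReal : stdGaussianDensity = gaussianPDFReal 0 1 := by
  ext x
  simp [stdGaussianDensity, gaussianPDFReal, div_eq_inv_mul, mul_comm]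

lemma stdGaussianDensity_pos (x : ℝ) : 0 < stdGaussianDensity x := by
  rw [stdGaussianDensity_eq_gaussianPDFReal]; exact gaussianPDFReal_pos _ _ _ one_ne_zero

lemma measurable_stdGaussianDensity : Measurable stdGaussianDensity := by
  rw [stdGaussianDensity_eq_gaussianPDFReal]; exact measurable_gaussianPDFReal _ _

lemma integrable_gaussianReal_iff {f : ℝ → ℝ} :
    Integrable f (gaussianReal 0 1) ↔ Integrable (fun x => f x * stdGaussianDensity x) := by
  rw [gaussianReal_of_var_ne_zero _ one_ne_zero, integrable_withDensity_iff
    (measurable_gaussianPDF _ _) (ae_of_all _ fun _ => gaussianPDF_lt_top)]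
  simp [stdGaussianDensity_eq_gaussianPDFReal, toReal_gaussianPDF]

lemma integral_gaussianReal_eq (f : ℝ → ℝ) :
    ∫ x, f x ∂(gaussianReal 0 1) = ∫ x, f x * stdGaussianDensity x := by
  simp [integral_gaussianReal_eq_integral_smul one_ne_zero,
    stdGaussianDensity_eq_gaussianPDFReal, mul_comm]

/-- Density of the law of `X` with respect to the standard normal distribution. -/
noncomputable def gaussianRatio {Ω : Type*} [MeasureSpace Ω] (X : Ω → ℝ) (x : ℝ) : ℝ :=
  (MeasureTheory.pdf X ℙ volume x).toReal / stdGaussianDensity x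

section Ratio

variable {Ω : Type*} [MeasureSpace Ω] {X : Ω → ℝ}

lemma measurable_gaussianRatio : Measurable (gaussianRatio X) :=
  (measurable_pdf X ℙ volume).ennreal_toReal.div measurable_stdGaussianDensity

lemma gaussianRatio_mul_mul (f : ℝ → ℝ) (x : ℝ) :
    gaussianRatio X x * f x * stdGaussianDensity x
      = (MeasureTheory.pdf X ℙ volume x).toReal • f x := by
  have := (stdGaussianDensity_pos x).ne'
  simp only [gaussianRatio, smul_eq_mul]
  field_simp

lemma hasMean_comp_iff [IsProbabilityMeasure (ℙ : Measure Ω)] [HasPDF X ℙ] {f : ℝ → ℝ}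
    (hf : Continuous f) {v : ℝ} :
    HasMean (gaussianReal 0 1) (fun x => gaussianRatio X x * f x) v ↔
      HasMean ℙ (fun ω => f (X ω)) v := by
  have hf' : AEStronglyMeasurable f volume := hf.aestronglyMeasurable
  simp only [HasMean, integrable_gaussianReal_iff, integral_gaussianReal_eq,
    gaussianRatio_mul_mul, pdf.integrable_pdf_smul_iff hf', pdf.integral_pdf_smul hf']

lemma memLp_gaussianRatio_sub_one (hfin : HasFiniteChiSq X) :
    MemLp (fun x => gaussianRatio X x - 1) 2 (gaussianReal 0 1) := by
  rw [memLp_two_iff_integrable_sq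
    (measurable_gaussianRatio.sub_const 1).aestronglyMeasurable, integrable_gaussianReal_iff]
  exact hfin

lemma integrable_exp_of_hasFiniteChiSq [IsProbabilityMeasure (ℙ : Measure Ω)] [HasPDF X ℙ]
    (hfin : HasFiniteChiSq X) (c : ℝ) : Integrable (fun ω => exp (c * X ω)) ℙ := by
  have hexp : MemLp (fun x => exp (c * x)) 2 (gaussianReal 0 1) := by
    rw [memLp_two_iff_integrable_sq (by fun_prop)]
    refine (hasMean_exp_gaussianReal (2 * c)).1.congr (ae_of_all _ fun x => ?_)
    simp only [← exp_nat_mul]; push_cast; ring_nf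
  have hint := ((memLp_gaussianRatio_sub_one hfin).integrable_mul hexp).add
    (hasMean_exp_gaussianReal c).1
  refine ((hasMean_comp_iff (X := X) (f := fun x => exp (c * x)) (by fun_prop)).1
    ⟨hint.congr (ae_of_all _ fun x => ?_), rfl⟩).1
  simp only [Pi.add_apply, Pi.mul_apply]
  ring

lemma integral_exp_neg_of_symmetric {μ : Measure Ω} (hX : AEMeasurable X μ)
    (hsym : Measure.map X μ = Measure.map (fun ω => -(X ω)) μ) (c : ℝ) :
    ∫ ω, exp (-c * X ω) ∂μ = ∫ ω, exp (c * X ω) ∂μ := by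
  have h1 := integral_map hX (f := fun x => exp (c * x)) (by fun_prop)
  have h2 := integral_map hX.neg (f := fun x => exp (c * x)) (by fun_prop)
  have hsym' : Measure.map (-X) μ = Measure.map X μ := hsym.symm
  rw [hsym', h1] at h2
  simpa using h2.symm

lemma hasMean_mul_evenExpTail [IsProbabilityMeasure (ℙ : Measure Ω)] [HasPDF X ℙ]
    (hfin : HasFiniteChiSq X)
    (hsym : Measure.map X ℙ = Measure.map (fun ω => -(X ω)) ℙ) (hvar : ∫ ω, (X ω) ^ 2 = 1)
    (t : ℝ) :
    HasMean (gaussianReal 0 1) (fun x => (gaussianRatio X x - 1) * evenExpTail t x)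
      (exp (-(t ^ 2 / 2)) * (∫ ω, exp (t * X ω)) - 1) := by
  have hsq : HasMean (ℙ : Measure Ω) (fun ω => X ω ^ 2) 1 := by
    refine ⟨?_, hvar⟩
    by_contra h
    simp [integral_undef h] at hvar
  have hX := HasMean.evenExpTail hsq ⟨integrable_exp_of_hasFiniteChiSq hfin t, rfl⟩
    ⟨integrable_exp_of_hasFiniteChiSq hfin (-t),
      integral_exp_neg_of_symmetric (HasPDF.aemeasurable X ℙ volume) hsym t⟩
  exact (((hasMean_comp_iff (continuous_evenExpTail t)).2 hX).sub
    (hasMean_evenExpTail_gaussianReal t)).congr (fun x => by ring) (by ring)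

end Ratio

theorem stmt17 {Ω : Type} [MeasureSpace Ω] [IsProbabilityMeasure (ℙ : Measure Ω)]
    (Y : Ω → ℝ) (hpdf : HasPDF Y ℙ) (hfin : HasFiniteChiSq Y)
    (hsym : Measure.map Y ℙ = Measure.map (fun ω => -(Y ω)) ℙ)
    (hmean : ∫ ω, Y ω = 0) (hvar : ∫ ω, (Y ω)^2 = 1)
    (hchi : chiSqDist Y < 1.97) :
    ∀ t : ℝ, t ≠ 0 →
      ∫⁻ ω, ENNReal.ofReal (Real.exp (t * Y ω)) < ENNReal.ofReal (Real.exp (t^2)) := by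
  intro t ht
  rw [← ofReal_integral_eq_lintegral_ofReal (integrable_exp_of_hasFiniteChiSq hfin t)
    (ae_of_all _ fun _ => (exp_pos _).le), ENNReal.ofReal_lt_ofReal_iff (exp_pos _)]
  have hprod := hasMean_mul_evenExpTail hfin hsym hvar t
  have hsq := hasMean_evenExpTail_sq_gaussianReal t
  have hD : HasMean (gaussianReal 0 1) (fun x => (gaussianRatio Y x - 1) ^ 2) (chiSqDist Y) :=
    ⟨integrable_gaussianReal_iff.2 hfin, integral_gaussianReal_eq _⟩
  obtain ⟨M, hM⟩ : ∃ M, ∫ ω, exp (t * Y ω) = M := ⟨_, rfl⟩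
  obtain ⟨u, hu⟩ : ∃ u, exp (t ^ 2 / 2) = u := ⟨_, rfl⟩
  have hu0 : 0 < u := hu ▸ exp_pos _
  have hu1 : 1 < u := by rw [← hu]; exact one_lt_exp_iff.2 (by positivity)
  have hgap := cosh_gap (w := t ^ 2 / 2) (by positivity)
  rw [show 2 * (t ^ 2 / 2) = t ^ 2 by ring, hu] at hgap
  rw [exp_neg, hu, hM] at hprod
  rw [hM, show exp (t ^ 2) = u * u by rw [← hu, ← exp_add]; ring_nf]
  have hquad := (hD.const_mul ((u - 1) ^ 2)).sub (hprod.const_mul (2 * 1.97 * (u - 1))) |>.add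
    (hsq.const_mul (1.97 ^ 2))
  have hnonneg := integral_nonneg_of_ae (μ := gaussianReal 0 1) <| ae_of_all _ fun x =>
    sq_nonneg ((u - 1) * (gaussianRatio Y x - 1) - 1.97 * evenExpTail t x)
  rw [(hquad.congr (fun x => by ring) rfl).2] at hnonneg
  have hlt : (u - 1) ^ 2 * chiSqDist Y < (u - 1) ^ 2 * 1.97 :=
    mul_lt_mul_of_pos_left hchi (by nlinarith)
  have hMu : (u - 1) * (u⁻¹ * M - 1) < (u - 1) * (u - 1) := by nlinarith
  have := lt_of_mul_lt_mul_left hMu (by linarith)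
  rw [← div_lt_iff₀' hu0, div_eq_inv_mul]
  linarith
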